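/- arXiv:1205.3234 — 3 statements merged into one kernel-verified Lean document; each statement's English description precedes it below -/
import Mathlib

section
/- Fix η₁ > 0 and let g(z) = ∫_0^1 ∫_0^1 ∫_0^1 (b_1² + a² b_2⁴)^z a^{η₁−1} db_1 db_2 da (with the convention 0^z := 0 on the measure-zero set where b_1² + a²b_2⁴ = 0), which defines a holomorphic function on {Re z > 0}. Put λ = min{3/4, (1+η₁)/2} and m = 2 if η₁ = 1/2, m = 1 otherwise. Then g extends holomorphically to {Re z > −λ}, and there is a function h, holomorphic on a neighborhood of z = −λ with h(−λ) ≠ 0, such that g(z) = h(z)/(z+λ)^m near z = −λ; i.e., the rightmost pole of the meromorphic continuation of g is at z = −λ and has order m. -/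
open MeasureTheory

/-- The zeta function `g(z) = ∫_{[0,1]³} (b₁² + a²b₂⁴)^z a^{η₁−1} db₁ db₂ da`, with the
convention `0^z := 0`; here `w = (a, b₁, b₂)`. -/
noncomputable def resolvedZeta (η₁ : ℝ) (z : ℂ) : ℂ :=
  ∫ w in Set.Icc (0 : ℝ) 1 ×ˢ Set.Icc (0 : ℝ) 1 ×ˢ Set.Icc (0 : ℝ) 1,
    (if w.2.1 ^ 2 + w.1 ^ 2 * w.2.2 ^ 4 = 0 then 0
      else ((w.2.1 ^ 2 + w.1 ^ 2 * w.2.2 ^ 4 : ℝ) : ℂ) ^ z) *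
    ((w.1 ^ (η₁ - 1) : ℝ) : ℂ)

open Set Metric

/-- Lebesgue measure on the half-open unit interval. -/
noncomputable def unitMeasure : Measure ℝ := volume.restrict (Ioc (0 : ℝ) 1)

instance : IsFiniteMeasure unitMeasure := by
  unfold unitMeasure; infer_instance

theorem ae_unitMeasure_mem : ∀ᵐ x ∂unitMeasure, x ∈ Ioc (0 : ℝ) 1 :=
  ae_restrict_mem measurableSet_Ioc

theorem ae_prod_unitMeasure_mem {α : Type*} [MeasurableSpace α] (μ : Measure α) [SFinite μ]
    {P : α → Prop} (hP : ∀ᵐ x ∂μ, P x) :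
    ∀ᵐ q ∂unitMeasure.prod μ, q.1 ∈ Ioc (0 : ℝ) 1 ∧ P q.2 :=
  (Measure.quasiMeasurePreserving_fst.ae ae_unitMeasure_mem).and
    (Measure.quasiMeasurePreserving_snd.ae hP)

theorem integral_unitMeasure (f : ℝ → ℂ) :
    ∫ x, f x ∂unitMeasure = ∫ x in (0 : ℝ)..1, f x := by
  rw [intervalIntegral.integral_of_le zero_le_one]; rfl

/-- Integrating over an initial segment of the unit interval amounts to rescaling. -/
theorem integral_unitMeasure_indicator_le (f : ℝ → ℂ) {c : ℝ} (hc : c ∈ Ioc (0 : ℝ) 1) :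
    ∫ x, (if x ≤ c then f x else 0) ∂unitMeasure = c * ∫ u, f (c * u) ∂unitMeasure := by
  have h1 : (fun x => if x ≤ c then f x else 0) = (Iic c).indicator f := by
    ext x; simp [indicator]
  rw [h1, integral_indicator measurableSet_Iic, unitMeasure, Measure.restrict_restrict
    measurableSet_Iic, ← unitMeasure, integral_unitMeasure,
    intervalIntegral.integral_comp_mul_left (f := f) hc.1.ne']
  have h2 : Iic c ∩ Ioc (0 : ℝ) 1 = Ioc 0 c := by
    ext x; simp only [mem_inter_iff, mem_Iic, mem_Ioc]
    exact ⟨fun h => ⟨h.2.1, h.1⟩, fun h => ⟨h.2, h.1, h.2.trans hc.2⟩⟩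
  rw [h2, mul_zero, mul_one, ← intervalIntegral.integral_of_le hc.1.le, Complex.real_smul,
    ← mul_assoc, ← Complex.ofReal_mul, mul_inv_cancel₀ hc.1.ne', Complex.ofReal_one, one_mul]

theorem integral_unitMeasure_cpow {r : ℂ} (hr : -1 < r.re) :
    ∫ x : ℝ, (x : ℂ) ^ r ∂unitMeasure = 1 / (r + 1) := by
  have h : r + 1 ≠ 0 := fun h => by
    have := congrArg Complex.re h
    simp at this; linarith
  rw [integral_unitMeasure, integral_cpow (Or.inl hr)]
  simp [Complex.zero_cpow h]

/-- The integral over the unit square of a function that is homogeneous of degree `d` with respect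
to the weights `(1, p)`, in terms of its values on the edges `t = 1` and `x = 1`. -/
theorem integral_unitSquare_of_homogeneous {f : ℝ × ℝ → ℂ} {p : ℝ} {d : ℂ} (hp : 0 < p)
    (hd : -1 < d.re) (hf : Integrable f (unitMeasure.prod unitMeasure))
    (hom : ∀ l t x : ℝ, 0 < l → 0 < t → 0 < x → f (l * t, l ^ p * x) = (l : ℂ) ^ d * f (t, x)) :
    ∫ q, f q ∂unitMeasure.prod unitMeasure =
      (∫ u, f (1, u) ∂unitMeasure + p * ∫ u, f (u, 1) ∂unitMeasure) / (d + p + 1) := by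
  have hS : MeasurableSet {q : ℝ × ℝ | q.2 ≤ q.1 ^ p} := by
    apply measurableSet_le <;> fun_prop
  rw [← integral_add_compl₀ hS.nullMeasurableSet hf, ← integral_indicator hS,
    ← integral_indicator hS.compl, integral_prod _ (hf.indicator hS),
    integral_prod_symm _ (hf.indicator hS.compl)]
  have hne : d + p + 1 ≠ 0 := fun h => by
    have := congrArg Complex.re h
    simp at this; linarith
  have hpC : (p : ℂ) ≠ 0 := by exact_mod_cast hp.ne'
  have below : ∫ t, ∫ x, {q : ℝ × ℝ | q.2 ≤ q.1 ^ p}.indicator f (t, x) ∂unitMeasure ∂unitMeasure =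
      ∫ t : ℝ, (t : ℂ) ^ (d + p) * ∫ u, f (1, u) ∂unitMeasure ∂unitMeasure := by
    refine integral_congr_ae (ae_unitMeasure_mem.mono fun t ht => ?_)
    have hc : t ^ p ∈ Ioc (0 : ℝ) 1 :=
      ⟨Real.rpow_pos_of_pos ht.1 _, Real.rpow_le_one ht.1.le ht.2 hp.le⟩
    have h1 := integral_unitMeasure_indicator_le (fun x => f (t, x)) hc
    have h2 : ∫ u, f (t, t ^ p * u) ∂unitMeasure = (t : ℂ) ^ d * ∫ u, f (1, u) ∂unitMeasure := by
      rw [← integral_const_mul]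
      refine integral_congr_ae (ae_unitMeasure_mem.mono fun u hu => ?_)
      simpa using hom t 1 u ht.1 one_pos hu.1
    simp only [indicator, mem_ofPred_eq]
    rw [h1, h2, Complex.cpow_add _ _ (by exact_mod_cast ht.1.ne'), Complex.ofReal_cpow ht.1.le]
    ring
  have above : ∫ x, ∫ t, {q : ℝ × ℝ | q.2 ≤ q.1 ^ p}ᶜ.indicator f (t, x)
        ∂unitMeasure ∂unitMeasure =
      ∫ x : ℝ, (x : ℂ) ^ ((d + 1) / p) * ∫ u, f (u, 1) ∂unitMeasure ∂unitMeasure := by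
    refine integral_congr_ae (ae_unitMeasure_mem.mono fun x hx => ?_)
    have hc : x ^ p⁻¹ ∈ Ioc (0 : ℝ) 1 :=
      ⟨Real.rpow_pos_of_pos hx.1 _, Real.rpow_le_one hx.1.le hx.2 (inv_nonneg.2 hp.le)⟩
    have h1 := integral_unitMeasure_indicator_le (fun t => f (t, x)) hc
    have h2 : ∫ u, f (x ^ p⁻¹ * u, x) ∂unitMeasure =
        (x : ℂ) ^ (d / p) * ∫ u, f (u, 1) ∂unitMeasure := by
      rw [← integral_const_mul]
      refine integral_congr_ae (ae_unitMeasure_mem.mono fun u hu => ?_)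
      have h3 := hom (x ^ p⁻¹) u 1 hc.1 hu.1 one_pos
      rw [Real.rpow_inv_rpow hx.1.le hp.ne', mul_one] at h3
      have h4 : ((x ^ p⁻¹ : ℝ) : ℂ) ^ d = (x : ℂ) ^ (d / p) := by
        have hx0 : (x : ℂ) ≠ 0 := by exact_mod_cast hx.1.ne'
        rw [Complex.cpow_def_of_ne_zero (by exact_mod_cast hc.1.ne'),
          Complex.cpow_def_of_ne_zero hx0, ← Complex.ofReal_log hc.1.le,
          ← Complex.ofReal_log hx.1.le, Real.log_rpow hx.1]
        push_cast
        congr 1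
        field_simp
      simp only [h3, h4]
    have h5 : ∫ t, {q : ℝ × ℝ | q.2 ≤ q.1 ^ p}ᶜ.indicator f (t, x) ∂unitMeasure =
        ∫ t, (if t ≤ x ^ p⁻¹ then f (t, x) else 0) ∂unitMeasure := by
      have hne : ∀ᵐ t ∂unitMeasure, t ≠ x ^ p⁻¹ :=
        ae_restrict_of_ae (Measure.ae_ne volume _)
      refine integral_congr_ae ?_
      filter_upwards [hne, ae_unitMeasure_mem] with t htne ht
      have : ¬ x ≤ t ^ p ↔ t ≤ x ^ p⁻¹ := by
        rw [not_le, Real.lt_rpow_inv_iff_of_pos ht.1.le hx.1.le hp |>.symm]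
        exact ⟨le_of_lt, fun h => lt_of_le_of_ne h htne⟩
      simp only [indicator, mem_compl_iff, mem_ofPred_eq, this]
    beta_reduce
    rw [h5, h1, h2, add_div, Complex.cpow_add _ _ (by exact_mod_cast hx.1.ne'),
      Complex.ofReal_cpow hx.1.le]
    push_cast
    rw [one_div]
    ring
  have hre : ((d + 1) / p).re = (d.re + 1) / p := by simp [Complex.div_ofReal_re]
  rw [below, above, integral_mul_const, integral_mul_const, integral_unitMeasure_cpow,
    integral_unitMeasure_cpow]
  · have h6 : (d + 1) / p + 1 = (d + p + 1) / p := by field_simp; ring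
    rw [h6]
    field_simp
  · rw [hre]
    have : 0 < (d.re + 1) / p := div_pos (by linarith) hp
    linarith
  · simp; linarith

section CpowIntegral

variable {α : Type*} [MeasurableSpace α] {μ : Measure α} {φ w : α → ℝ}

theorem integrable_cpow_mul (hφ : Measurable φ) (hbd : ∀ᵐ x ∂μ, 0 < φ x ∧ φ x ≤ 2)
    (hw : Integrable w μ) {z : ℂ} (hz : 0 ≤ z.re) :
    Integrable (fun x => (φ x : ℂ) ^ z * (w x : ℂ)) μ := by
  refine hw.ofReal.bdd_mul (c := 2 ^ z.re) ?_ ?_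
  · exact (Measurable.pow_const (Complex.measurable_ofReal.comp hφ) z).aestronglyMeasurable
  · filter_upwards [hbd] with x hx
    rw [Complex.norm_cpow_eq_rpow_re_of_pos hx.1]
    exact Real.rpow_le_rpow hx.1.le hx.2 hz

theorem differentiable_integral_cpow_mul (hφ : Measurable φ)
    (hbd : ∀ᵐ x ∂μ, 1 ≤ φ x ∧ φ x ≤ 2) (hw : Integrable w μ) :
    Differentiable ℂ fun z : ℂ => ∫ x, (φ x : ℂ) ^ z * (w x : ℂ) ∂μ := by
  intro z₀
  have hφC : Measurable fun x => (φ x : ℂ) := Complex.measurable_ofReal.comp hφ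
  have hnorm : ∀ᵐ x ∂μ, ∀ z ∈ ball z₀ 1, ‖(φ x : ℂ) ^ z‖ ≤ 2 ^ (‖z₀‖ + 1) := by
    filter_upwards [hbd] with x hx z hz
    rw [Complex.norm_cpow_eq_rpow_re_of_pos (by linarith)]
    have h1 : z.re ≤ ‖z₀‖ + 1 := by
      have h2 := Complex.re_le_norm z
      have h3 := norm_sub_norm_le z z₀
      rw [mem_ball, dist_eq_norm] at hz
      linarith
    calc φ x ^ z.re ≤ φ x ^ (‖z₀‖ + 1) := Real.rpow_le_rpow_of_exponent_le hx.1 h1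
      _ ≤ 2 ^ (‖z₀‖ + 1) := Real.rpow_le_rpow (by linarith) hx.2 (by positivity)
  have key := hasDerivAt_integral_of_dominated_loc_of_deriv_le (μ := μ) (x₀ := z₀)
    (F := fun z x => (φ x : ℂ) ^ z * (w x : ℂ))
    (F' := fun z x => (φ x : ℂ) ^ z * Complex.log (φ x) * (w x : ℂ))
    (bound := fun x => 2 ^ (‖z₀‖ + 1) * ‖w x‖) (s := ball z₀ 1) (ball_mem_nhds _ one_pos)
    (Filter.Eventually.of_forall fun z =>
      (hφC.pow_const z).aestronglyMeasurable.mul hw.ofReal.aestronglyMeasurable)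
    (hw.ofReal.bdd_mul (hφC.pow_const z₀).aestronglyMeasurable
      (hnorm.mono fun x hx => hx z₀ (mem_ball_self one_pos)))
    (((hφC.pow_const z₀).mul hφC.clog).aestronglyMeasurable.mul
      hw.ofReal.aestronglyMeasurable)
    ?_ (hw.norm.const_mul _) ?_
  · exact key.2.differentiableAt
  · filter_upwards [hbd, hnorm] with x hx hn z hz
    have hlog : ‖Complex.log (φ x)‖ ≤ 1 := by
      rw [← Complex.ofReal_log (by linarith), Complex.norm_real, Real.norm_eq_abs,
        abs_of_nonneg (Real.log_nonneg hx.1)]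
      have := Real.log_le_sub_one_of_pos (x := φ x) (by linarith)
      linarith
    rw [norm_mul, norm_mul, Complex.norm_real]
    have := mul_le_mul (hn z hz) hlog (norm_nonneg _) (by positivity)
    rw [mul_one] at this
    exact mul_le_mul_of_nonneg_right this (norm_nonneg _)
  · filter_upwards [hbd] with x hx z _
    have h0 : (φ x : ℂ) ≠ 0 := by
      have : φ x ≠ 0 := by linarith
      exact_mod_cast this
    exact ((hasDerivAt_id z).const_cpow (Or.inl h0)).mul_const _ |>.congr_deriv (by simp)

theorem integral_cpow_mul_ofReal (hφ : ∀ᵐ x ∂μ, 0 < φ x) (s : ℝ) :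
    ∫ x, (φ x : ℂ) ^ (s : ℂ) * (w x : ℂ) ∂μ = ((∫ x, φ x ^ s * w x ∂μ : ℝ) : ℂ) := by
  rw [← integral_complex_ofReal]
  refine integral_congr_ae (hφ.mono fun x hx => ?_)
  simp only
  rw [← Complex.ofReal_cpow hx.le, Complex.ofReal_mul]

end CpowIntegral

theorem integrable_unitMeasure_rpow {η : ℝ} (hη : 0 < η) :
    Integrable (fun a : ℝ => a ^ (η - 1)) unitMeasure := by
  have := intervalIntegral.intervalIntegrable_rpow' (a := 0) (b := 1) (r := η - 1) (by linarith)
  rwa [intervalIntegrable_iff_integrableOn_Ioc_of_le zero_le_one] at this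

/-- The contribution of the edges `y = 1` and `x = 1` to the integral of `(x² + y⁴)^z`. -/
noncomputable def edgeIntegral (z : ℂ) : ℂ :=
  ∫ u : ℝ, ((u ^ 2 + 1 : ℝ) : ℂ) ^ z * ((1 : ℝ) : ℂ) ∂unitMeasure +
    2 * ∫ u : ℝ, ((1 + u ^ 4 : ℝ) : ℂ) ^ z * ((1 : ℝ) : ℂ) ∂unitMeasure

/-- The contribution of the face `b₁ = 1` to the zeta function; here `q = (a, b₂)`. -/
noncomputable def faceIntegral (η : ℝ) (z : ℂ) : ℂ :=
  ∫ q : ℝ × ℝ, ((1 + q.1 ^ 2 * q.2 ^ 4 : ℝ) : ℂ) ^ z * ((q.1 ^ (η - 1) : ℝ) : ℂ)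
    ∂unitMeasure.prod unitMeasure

theorem integrable_fst_rpow {η : ℝ} (hη : 0 < η) :
    Integrable (fun q : ℝ × ℝ => q.1 ^ (η - 1)) (unitMeasure.prod unitMeasure) :=
  (integrable_unitMeasure_rpow hη).comp_fst _

theorem differentiable_edgeIntegral : Differentiable ℂ edgeIntegral := by
  refine (differentiable_integral_cpow_mul (by fun_prop) ?_ (integrable_const 1)).add
    ((differentiable_integral_cpow_mul (by fun_prop) ?_ (integrable_const 1)).const_mul 2)
  · filter_upwards [ae_unitMeasure_mem] with u hu
    have := pow_le_one₀ (n := 2) hu.1.le hu.2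
    exact ⟨by nlinarith, by linarith⟩
  · filter_upwards [ae_unitMeasure_mem] with u hu
    have := pow_le_one₀ (n := 4) hu.1.le hu.2
    exact ⟨by nlinarith [pow_pos hu.1 4], by linarith⟩

theorem differentiable_faceIntegral {η : ℝ} (hη : 0 < η) :
    Differentiable ℂ (faceIntegral η) := by
  refine differentiable_integral_cpow_mul (by fun_prop) ?_ (integrable_fst_rpow hη)
  filter_upwards [ae_prod_unitMeasure_mem _ ae_unitMeasure_mem] with q hq
  have h1 := pow_le_one₀ (n := 2) hq.1.1.le hq.1.2
  have h2 := pow_le_one₀ (n := 4) hq.2.1.le hq.2.2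
  have h3 := pow_pos hq.1.1 2
  have h4 := pow_pos hq.2.1 4
  exact ⟨by nlinarith, by nlinarith⟩

theorem exists_edgeIntegral_ofReal (s : ℝ) : ∃ c : ℝ, 0 < c ∧ edgeIntegral s = c := by
  have hpos : ∀ φ : ℝ → ℝ, Continuous φ → (∀ u, 0 < φ u) →
      0 < ∫ u, φ u ^ s * 1 ∂unitMeasure := fun φ hφ h0 => by
    have := intervalIntegral.intervalIntegral_pos_of_pos (a := 0) (b := 1)
      (f := fun u => φ u ^ s * 1)
      (Continuous.intervalIntegrable
        ((hφ.rpow_const fun u => Or.inl (h0 u).ne').mul continuous_const) _ _)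
      (fun u => mul_pos (Real.rpow_pos_of_pos (h0 u) _) one_pos) one_pos
    rwa [intervalIntegral.integral_of_le zero_le_one] at this
  have h2 : ∀ u : ℝ, 0 < u ^ 2 + 1 := fun u => by positivity
  have h4 : ∀ u : ℝ, 0 < 1 + u ^ 4 := fun u => by positivity
  refine ⟨_, add_pos (hpos (fun u => u ^ 2 + 1) (by fun_prop) h2)
    (mul_pos two_pos (hpos (fun u => 1 + u ^ 4) (by fun_prop) h4)), ?_⟩
  rw [edgeIntegral, integral_cpow_mul_ofReal (.of_forall h2), integral_cpow_mul_ofReal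
    (.of_forall h4)]
  push_cast
  rfl

theorem exists_faceIntegral_ofReal (η s : ℝ) : ∃ c : ℝ, 0 ≤ c ∧ faceIntegral η s = c := by
  refine ⟨_, ?_, integral_cpow_mul_ofReal (.of_forall fun q => by positivity) s⟩
  refine integral_nonneg_of_ae ?_
  filter_upwards [ae_prod_unitMeasure_mem _ ae_unitMeasure_mem] with q hq
  have := Real.rpow_nonneg hq.1.1.le (η - 1)
  simp only [Pi.zero_apply]
  positivity

theorem ofReal_cpow_of_eq_pow_mul {l c d : ℝ} (n : ℕ) (z : ℂ) (hl : 0 < l) (hc : 0 ≤ c)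
    (h : d = l ^ n * c) : (d : ℂ) ^ z = (l : ℂ) ^ (n * z) * (c : ℂ) ^ z := by
  have hln : (0 : ℝ) < l ^ n := by positivity
  rw [h, Complex.ofReal_mul, Complex.mul_cpow_ofReal_nonneg hln.le hc]
  congr 1
  rw [Complex.cpow_def_of_ne_zero (by exact_mod_cast hln.ne'),
    Complex.cpow_def_of_ne_zero (by exact_mod_cast hl.ne'), ← Complex.ofReal_log hln.le,
    ← Complex.ofReal_log hl.le, Real.log_pow]
  push_cast
  ring_nf

/-- The integral of `(x² + y⁴)^z` over the unit square; here `q = (y, x)`. -/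
theorem integral_cpow_unitSquare {z : ℂ} (hz : 0 < z.re) :
    Integrable (fun q : ℝ × ℝ => ((q.2 ^ 2 + q.1 ^ 4 : ℝ) : ℂ) ^ z)
      (unitMeasure.prod unitMeasure) ∧
    ∫ q : ℝ × ℝ, ((q.2 ^ 2 + q.1 ^ 4 : ℝ) : ℂ) ^ z ∂unitMeasure.prod unitMeasure =
      edgeIntegral z / (4 * z + 3) := by
  have hint : Integrable (fun q : ℝ × ℝ => ((q.2 ^ 2 + q.1 ^ 4 : ℝ) : ℂ) ^ z)
      (unitMeasure.prod unitMeasure) := by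
    have := integrable_cpow_mul (μ := unitMeasure.prod unitMeasure)
      (φ := fun q : ℝ × ℝ => q.2 ^ 2 + q.1 ^ 4) (by fun_prop) ?_ (integrable_const 1) hz.le
    · simpa only [Complex.ofReal_one, mul_one] using this
    filter_upwards [ae_prod_unitMeasure_mem _ ae_unitMeasure_mem] with q hq
    have h1 := pow_le_one₀ (n := 4) hq.1.1.le hq.1.2
    have h2 := pow_le_one₀ (n := 2) hq.2.1.le hq.2.2
    have h3 := pow_pos hq.1.1 4
    have h4 := pow_pos hq.2.1 2
    exact ⟨by linarith, by linarith⟩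
  refine ⟨hint, ?_⟩
  rw [integral_unitSquare_of_homogeneous (p := 2) (d := 4 * z) two_pos
    (by simp; linarith) hint fun l t x hl _ _ => ?_]
  · simp only [edgeIntegral, Complex.ofReal_one, mul_one, one_pow, Complex.ofReal_ofNat]
    congr 1
    ring
  · have := ofReal_cpow_of_eq_pow_mul (c := x ^ 2 + t ^ 4)
      (d := (l ^ (2 : ℝ) * x) ^ 2 + (l * t) ^ 4) 4 z hl (by positivity)
      (by rw [Real.rpow_two]; ring)
    simpa using this

theorem resolvedZeta_eq_integral (η : ℝ) (z : ℂ) :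
    resolvedZeta η z = ∫ w : ℝ × ℝ × ℝ, ((w.2.1 ^ 2 + w.1 ^ 2 * w.2.2 ^ 4 : ℝ) : ℂ) ^ z *
      ((w.1 ^ (η - 1) : ℝ) : ℂ) ∂unitMeasure.prod (unitMeasure.prod unitMeasure) := by
  have hμ : volume.restrict (Icc (0 : ℝ) 1) = unitMeasure :=
    (Measure.restrict_congr_set Ioc_ae_eq_Icc).symm
  rw [resolvedZeta, Measure.volume_eq_prod, ← Measure.prod_restrict, Measure.volume_eq_prod,
    ← Measure.prod_restrict, hμ]
  refine integral_congr_ae ?_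
  filter_upwards [ae_prod_unitMeasure_mem _ (ae_prod_unitMeasure_mem _ ae_unitMeasure_mem)]
    with w hw
  have h1 := pow_pos hw.2.1.1 2
  have h2 := pow_pos hw.1.1 2
  have h3 := pow_pos hw.2.2.1 4
  rw [if_neg (by positivity)]

theorem integral_cpow_slice {η : ℝ} (hη : 0 < η) {z : ℂ} (hz : 0 < z.re) {y : ℝ}
    (hy : y ∈ Ioc (0 : ℝ) 1) :
    ∫ q : ℝ × ℝ, ((q.2 ^ 2 + q.1 ^ 2 * y ^ 4 : ℝ) : ℂ) ^ z * ((q.1 ^ (η - 1) : ℝ) : ℂ)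
        ∂unitMeasure.prod unitMeasure =
      (∫ x : ℝ, ((x ^ 2 + y ^ 4 : ℝ) : ℂ) ^ z ∂unitMeasure +
        ∫ a : ℝ, ((1 + a ^ 2 * y ^ 4 : ℝ) : ℂ) ^ z * ((a ^ (η - 1) : ℝ) : ℂ) ∂unitMeasure) /
      (2 * z + 1 + η) := by
  have hy4 := pow_pos hy.1 4
  have hy4' := pow_le_one₀ (n := 4) hy.1.le hy.2
  rw [integral_unitSquare_of_homogeneous (p := 1) (d := 2 * z + (η - 1 : ℝ)) one_pos
    (by simp; linarith) ?_ fun l t x hl ht _ => ?_]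
  · simp only [one_pow, one_mul, Real.one_rpow, Complex.ofReal_one, mul_one]
    push_cast
    congr 1
    ring
  · refine integrable_cpow_mul (by fun_prop) ?_ (integrable_fst_rpow hη) hz.le
    filter_upwards [ae_prod_unitMeasure_mem _ ae_unitMeasure_mem] with q hq
    have h1 := pow_le_one₀ (n := 2) hq.1.1.le hq.1.2
    have h2 := pow_le_one₀ (n := 2) hq.2.1.le hq.2.2
    have h3 := pow_pos hq.1.1 2
    have h4 := pow_pos hq.2.1 2
    exact ⟨by positivity, by nlinarith⟩
  · have h := ofReal_cpow_of_eq_pow_mul (c := x ^ 2 + t ^ 2 * y ^ 4)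
      (d := (l ^ (1 : ℝ) * x) ^ 2 + (l * t) ^ 2 * y ^ 4) 2 z hl (by positivity)
      (by rw [Real.rpow_one]; ring)
    rw [Complex.cpow_add _ _ (by exact_mod_cast hl.ne'), ← Complex.ofReal_cpow hl.le]
    simp only
    rw [h, Real.mul_rpow hl.le ht.le]
    push_cast
    ring

/-- The zeta function on the half-plane of absolute convergence, in terms of entire functions. -/
theorem resolvedZeta_eq {η : ℝ} (hη : 0 < η) {z : ℂ} (hz : 0 < z.re) :
    resolvedZeta η z =
      (edgeIntegral z / (4 * z + 3) + faceIntegral η z) / (2 * z + 1 + η) := by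
  have hint : Integrable (fun w : ℝ × ℝ × ℝ => ((w.2.1 ^ 2 + w.1 ^ 2 * w.2.2 ^ 4 : ℝ) : ℂ) ^ z *
      ((w.1 ^ (η - 1) : ℝ) : ℂ)) (unitMeasure.prod (unitMeasure.prod unitMeasure)) := by
    refine integrable_cpow_mul (by fun_prop) ?_ ((integrable_unitMeasure_rpow hη).comp_fst _) hz.le
    filter_upwards [ae_prod_unitMeasure_mem _ (ae_prod_unitMeasure_mem _ ae_unitMeasure_mem)]
      with w hw
    have h1 := pow_pos hw.2.1.1 2
    have h2 := pow_pos hw.1.1 2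
    have h3 := pow_pos hw.2.2.1 4
    have h1' := pow_le_one₀ (n := 2) hw.2.1.1.le hw.2.1.2
    have h2' := pow_le_one₀ (n := 2) hw.1.1.le hw.1.2
    have h3' := pow_le_one₀ (n := 4) hw.2.2.1.le hw.2.2.2
    exact ⟨by positivity, by nlinarith⟩
  have hassoc := measurePreserving_prodAssoc unitMeasure unitMeasure unitMeasure
  have hint_assoc := hassoc.integrable_comp_of_integrable hint
  rw [resolvedZeta_eq_integral, ← hassoc.integral_comp' (f := MeasurableEquiv.prodAssoc),
    integral_prod_symm _ (by exact hint_assoc)]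
  obtain ⟨hsq, hsqeq⟩ := integral_cpow_unitSquare hz
  have hface : Integrable (fun q : ℝ × ℝ => ((1 + q.1 ^ 2 * q.2 ^ 4 : ℝ) : ℂ) ^ z *
      ((q.1 ^ (η - 1) : ℝ) : ℂ)) (unitMeasure.prod unitMeasure) := by
    refine integrable_cpow_mul (by fun_prop) ?_ (integrable_fst_rpow hη) hz.le
    filter_upwards [ae_prod_unitMeasure_mem _ ae_unitMeasure_mem] with q hq
    have h1 := pow_le_one₀ (n := 2) hq.1.1.le hq.1.2
    have h2 := pow_le_one₀ (n := 4) hq.2.1.le hq.2.2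
    exact ⟨by positivity, by nlinarith [pow_pos hq.1.1 2]⟩
  rw [← hsqeq, faceIntegral, integral_prod _ hsq, integral_prod_symm _ hface,
    ← integral_add hsq.integral_prod_left hface.integral_prod_right, ← integral_div]
  exact integral_congr_ae (ae_unitMeasure_mem.mono fun y hy => integral_cpow_slice hη hz hy)

theorem linear_ne_zero_of_lt_re {c r : ℝ} (hc : 0 < c) {z : ℂ} (hz : -(r / c) < z.re) :
    (c : ℂ) * z + r ≠ 0 := fun h => by
  have h1 := congrArg Complex.re h
  simp at h1
  rw [neg_lt_iff_pos_add, ← mul_lt_mul_iff_right₀ hc, mul_add, mul_div_cancel₀ _ hc.ne'] at hz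
  linarith

/-- `g` is holomorphic on `{Re z > 0}`, extends holomorphically to
`{Re z > −λ}` with `λ = min{3/4, (1+η₁)/2}`, and the rightmost pole of its meromorphic
continuation is at `z = −λ`, of order `m = 2` if `η₁ = 1/2` and `m = 1` otherwise. -/
theorem resolved_zeta_rightmost_pole
    (η₁ : ℝ) (hη₁ : 0 < η₁)
    (lam : ℝ) (hlam : lam = min (3 / 4 : ℝ) ((1 + η₁) / 2))
    (m : ℕ) (hm : m = if η₁ = 1 / 2 then 2 else 1) :
    AnalyticOnNhd ℂ (resolvedZeta η₁) {z : ℂ | 0 < z.re} ∧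
    ∃ G : ℂ → ℂ,
      AnalyticOnNhd ℂ G {z : ℂ | -lam < z.re} ∧
      (∀ z : ℂ, 0 < z.re → G z = resolvedZeta η₁ z) ∧
      ∃ ε > (0 : ℝ), ∃ h : ℂ → ℂ,
        AnalyticOnNhd ℂ h (Metric.ball (-(lam : ℂ)) ε) ∧
        h (-(lam : ℂ)) ≠ 0 ∧
        ∀ z ∈ Metric.ball (-(lam : ℂ)) ε, -lam < z.re →
          G z = h z / (z + (lam : ℂ)) ^ m := by
  have hE := differentiable_edgeIntegral
  have hF := differentiable_faceIntegral hη₁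
  have hlam1 : lam ≤ 3 / 4 := hlam ▸ min_le_left _ _
  have hlam2 : lam ≤ (1 + η₁) / 2 := hlam ▸ min_le_right _ _
  set G : ℂ → ℂ := fun z =>
    (edgeIntegral z / (4 * z + 3) + faceIntegral η₁ z) / (2 * z + 1 + η₁) with hGdef
  have hne1 : ∀ z : ℂ, -(3 / 4) < z.re → 4 * z + 3 ≠ 0 := fun z hz => by
    exact_mod_cast linear_ne_zero_of_lt_re (c := 4) (r := 3) (by norm_num) hz
  have hne2 : ∀ z : ℂ, -((1 + η₁) / 2) < z.re → 2 * z + 1 + η₁ ≠ 0 := fun z hz => by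
    have := linear_ne_zero_of_lt_re (c := 2) (r := 1 + η₁) (by norm_num) hz
    rw [add_assoc]
    exact_mod_cast this
  have hG : AnalyticOnNhd ℂ G {z : ℂ | -lam < z.re} := by
    refine DifferentiableOn.analyticOnNhd (fun z hz => ?_)
      (isOpen_lt continuous_const Complex.continuous_re)
    rw [mem_ofPred_eq] at hz
    refine DifferentiableAt.differentiableWithinAt ?_
    refine (((hE z).div (by fun_prop) (hne1 z ?_)).add (hF z)).div (by fun_prop) (hne2 z ?_) <;>
      linarith
  have hGeq : ∀ z : ℂ, 0 < z.re → G z = resolvedZeta η₁ z := fun z hz =>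
    (resolvedZeta_eq hη₁ hz).symm
  have hlampos : 0 < lam := by rw [hlam]; exact lt_min (by norm_num) (by linarith)
  refine ⟨(hG.mono fun z (hz : 0 < z.re) => ?_).congr
    (isOpen_lt continuous_const Complex.continuous_re) hGeq, G, hG, hGeq, ?_⟩
  · rw [mem_ofPred_eq]; linarith
  have hball : ∀ {ε : ℝ} {z : ℂ}, z ∈ ball (-(lam : ℂ)) ε → -lam - ε < z.re := fun {ε z} hz => by
    rw [mem_ball, dist_eq_norm] at hz
    have := (abs_lt.1 ((Complex.abs_re_le_norm _).trans_lt hz)).1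
    simp at this
    linarith
  have hdiff : Differentiable ℂ fun z => edgeIntegral z + (4 * z + 3) * faceIntegral η₁ z := by
    fun_prop
  obtain ⟨c, hc, hcE⟩ := exists_edgeIntegral_ofReal (-lam)
  obtain ⟨e, he, heF⟩ := exists_faceIntegral_ofReal η₁ (-lam)
  rw [Complex.ofReal_neg] at hcE heF
  rcases lt_trichotomy η₁ (1 / 2) with hlt | heq | hgt
  · have hl : lam = (1 + η₁) / 2 := by rw [hlam]; exact min_eq_right (by linarith)
    rw [if_neg hlt.ne] at hm
    have hne : ∀ z ∈ ball (-(lam : ℂ)) (3 / 4 - lam), 4 * z + 3 ≠ 0 := fun z hz =>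
      hne1 z (by have := hball hz; linarith)
    refine ⟨3 / 4 - lam, by linarith, fun z =>
      (edgeIntegral z / (4 * z + 3) + faceIntegral η₁ z) / 2, ?_, ?_, fun z _ _ => ?_⟩
    · refine DifferentiableOn.analyticOnNhd (fun z hz => ?_) isOpen_ball
      refine DifferentiableAt.differentiableWithinAt ?_
      exact (((hE z).div (by fun_prop) (hne z hz)).add (hF z)).div_const 2
    · have hpos : 0 < (c / (4 * -lam + 3) + e) / 2 := by
        have : 0 < 4 * -lam + 3 := by linarith
        positivity
      beta_reduce
      rw [hcE, heF]
      exact_mod_cast hpos.ne'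
    · have : 2 * z + 1 + η₁ = 2 * (z + lam) := by rw [hl]; push_cast; ring
      rw [hm, pow_one, hGdef]
      simp only
      rw [this, div_div]
  · have hl : lam = 3 / 4 := by rw [hlam, heq]; norm_num
    rw [if_pos heq] at hm
    refine ⟨1, one_pos, fun z => (edgeIntegral z + (4 * z + 3) * faceIntegral η₁ z) / 8,
      (hdiff.div_const 8).differentiableOn.analyticOnNhd isOpen_ball, ?_, fun z _ hz => ?_⟩
    · have hpos : 0 < (c + (4 * -lam + 3) * e) / 8 := by rw [hl]; norm_num; exact hc
      beta_reduce
      rw [hcE, heF]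
      exact_mod_cast hpos.ne'
    · have h4 : 4 * z + 3 ≠ 0 := hne1 z (by linarith)
      have h1 : z + lam = (4 * z + 3) / 4 := by rw [hl]; push_cast; ring
      have h2 : 2 * z + 1 + η₁ = (4 * z + 3) / 2 := by rw [heq]; push_cast; ring
      rw [hm, hGdef]
      simp only
      rw [h1, h2]
      field_simp
      ring
  · have hl : lam = 3 / 4 := by rw [hlam]; exact min_eq_left (by linarith)
    rw [if_neg hgt.ne'] at hm
    have hne : ∀ z ∈ ball (-(lam : ℂ)) ((1 + η₁) / 2 - lam), 2 * z + 1 + η₁ ≠ 0 := fun z hz =>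
      hne2 z (by have := hball hz; linarith)
    refine ⟨(1 + η₁) / 2 - lam, by linarith, fun z =>
      (edgeIntegral z + (4 * z + 3) * faceIntegral η₁ z) / (4 * (2 * z + 1 + η₁)),
      ?_, ?_, fun z hzb hz => ?_⟩
    · refine DifferentiableOn.analyticOnNhd (fun z hz => ?_) isOpen_ball
      refine DifferentiableAt.differentiableWithinAt ?_
      exact (hdiff z).div (by fun_prop) (mul_ne_zero (by norm_num) (hne z hz))
    · have hpos : 0 < (c + (4 * -lam + 3) * e) / (4 * (2 * -lam + 1 + η₁)) := by
        refine div_pos ?_ (by linarith)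
        rw [hl]; norm_num; exact hc
      beta_reduce
      rw [hcE, heF]
      exact_mod_cast hpos.ne'
    · have h4 : 4 * z + 3 ≠ 0 := hne1 z (by linarith)
      have h2 := hne z hzb
      have h1 : z + lam = (4 * z + 3) / 4 := by rw [hl]; push_cast; ring
      rw [hm, pow_one, hGdef]
      simp only
      rw [h1]
      field_simp
end

section
/- Let h_0 : ℝ^{d−1} → ℝ and h_1 : ℝ^d → ℝ be polynomial functions, let B > 0 and let K ⊂ ℝ^{d−1} be compact. Then there exist constants 0 < c ≤ C such that for all w_1 ∈ [0,B] and all v ∈ K: c·(w_1 + h_0(v)²) ≤ w_1 + (h_0(v) + w_1·h_1(w_1,v))² ≤ C·(w_1 + h_0(v)²). -/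
/-- A perturbation `e` with `e² ≤ N w` changes `w + a²` by at most the factor `2 + 2N`. -/
theorem add_sq_perturb_le {a e w N : ℝ} (hN : 0 ≤ N) (hw : 0 ≤ w) (he : e ^ 2 ≤ N * w) :
    w + (a + e) ^ 2 ≤ (2 + 2 * N) * (w + a ^ 2) := by
  nlinarith [sq_nonneg (a - e), mul_nonneg hN (sq_nonneg a)]

/-- the Newton-diagram equivalence `w₁ + (h₀ + w₁h₁)² ≡ w₁ + h₀²` on
`[0,B] × K` for polynomial functions `h₀ : ℝ^{d−1} → ℝ` (variables `v`) and
`h₁ : ℝ^d → ℝ` (variables `(w₁, v)`), `K` compact. -/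
theorem newton_diagram_equivalence_linear
    (d : ℕ) (h₀ : MvPolynomial (Fin d) ℝ) (h₁ : MvPolynomial (Fin (d + 1)) ℝ)
    (B : ℝ) (hB : 0 < B) (K : Set (Fin d → ℝ)) (hK : IsCompact K) :
    ∃ c C : ℝ, 0 < c ∧ c ≤ C ∧
      ∀ w₁ ∈ Set.Icc (0 : ℝ) B, ∀ v ∈ K,
        c * (w₁ + MvPolynomial.eval v h₀ ^ 2) ≤
            w₁ + (MvPolynomial.eval v h₀ +
              w₁ * MvPolynomial.eval (Fin.cons w₁ v) h₁) ^ 2 ∧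
        w₁ + (MvPolynomial.eval v h₀ +
              w₁ * MvPolynomial.eval (Fin.cons w₁ v) h₁) ^ 2 ≤
          C * (w₁ + MvPolynomial.eval v h₀ ^ 2) := by
  have hcont : ContinuousOn
      (fun p : ℝ × (Fin d → ℝ) =>
        MvPolynomial.eval (Fin.cons p.1 p.2 : Fin (d + 1) → ℝ) h₁)
      (Set.Icc 0 B ×ˢ K) := by
    refine ((MvPolynomial.continuous_eval h₁).comp ?_).continuousOn
    exact Continuous.finCons (A := fun _ => ℝ) continuous_fst continuous_snd
  obtain ⟨M, hM⟩ := (isCompact_Icc.prod hK).exists_bound_of_continuousOn hcont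
  have hN : 0 ≤ B * M ^ 2 := by positivity
  have hC : 1 ≤ 2 + 2 * (B * M ^ 2) := by linarith
  refine ⟨(2 + 2 * (B * M ^ 2))⁻¹, 2 + 2 * (B * M ^ 2), by positivity,
    (inv_le_one_of_one_le₀ hC).trans hC, fun w hw v hv => ?_⟩
  have hb : |MvPolynomial.eval (Fin.cons w v) h₁| ≤ M := hM (w, v) ⟨hw, hv⟩
  generalize MvPolynomial.eval (Fin.cons w v) h₁ = b at hb ⊢
  generalize MvPolynomial.eval v h₀ = a
  have he : (w * b) ^ 2 ≤ B * M ^ 2 * w := by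
    have hb2 : b ^ 2 ≤ M ^ 2 := sq_le_sq' (abs_le.mp hb).1 (abs_le.mp hb).2
    have hw2 : w * w ≤ B * w := mul_le_mul_of_nonneg_right hw.2 hw.1
    calc (w * b) ^ 2 = w * w * b ^ 2 := by ring
      _ ≤ B * w * M ^ 2 := mul_le_mul hw2 hb2 (sq_nonneg b) (mul_nonneg hB.le hw.1)
      _ = B * M ^ 2 * w := by ring
  refine ⟨?_, add_sq_perturb_le hN hw.1 he⟩
  rw [inv_mul_le_iff₀ (by positivity)]
  have h := add_sq_perturb_le (a := a + w * b) (e := -(w * b)) hN hw.1 (by rwa [neg_sq])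
  rwa [add_neg_cancel_right] at h
end

section
/- Let h_0 : ℝ^{d−1} → ℝ and h_1 : ℝ^d → ℝ be polynomial functions, let B > 0 and let K ⊂ ℝ^{d−1} be compact. Then there exist constants 0 < c ≤ C such that for all w_1 ∈ [−B,B] and all v ∈ K: c·(w_1² + h_0(v)²) ≤ w_1² + (h_0(v) + w_1·h_1(w_1,v))² ≤ C·(w_1² + h_0(v)²). -/
theorem sq_add_sq_add_mul_le {w a b M : ℝ} (hb : |b| ≤ M) :
    w ^ 2 + (a + w * b) ^ 2 ≤ (2 + 2 * M ^ 2) * (w ^ 2 + a ^ 2) := by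
  have hsq : b ^ 2 ≤ M ^ 2 := sq_le_sq.mpr (hb.trans (le_abs_self M))
  have hmul : w ^ 2 * b ^ 2 ≤ w ^ 2 * M ^ 2 := by gcongr
  nlinarith [sq_nonneg (a - w * b), sq_nonneg w, mul_nonneg (sq_nonneg M) (sq_nonneg a)]

theorem MvPolynomial.exists_abs_eval_cons_le {d : ℕ} (p : MvPolynomial (Fin (d + 1)) ℝ)
    {I : Set ℝ} (hI : IsCompact I) {K : Set (Fin d → ℝ)} (hK : IsCompact K) :
    ∃ M : ℝ, ∀ w ∈ I, ∀ v ∈ K, |MvPolynomial.eval (Fin.cons w v) p| ≤ M := by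
  have hcons : Continuous fun x : ℝ × (Fin d → ℝ) => (Fin.cons x.1 x.2 : Fin (d + 1) → ℝ) :=
    Continuous.finCons (A := fun _ => ℝ) continuous_fst continuous_snd
  obtain ⟨M, hM⟩ := (hI.prod hK).exists_bound_of_continuousOn
    ((MvPolynomial.continuous_eval p).comp hcons).continuousOn
  exact ⟨M, fun w hw v hv => hM (w, v) ⟨hw, hv⟩⟩

/-- the Newton-diagram equivalence `w₁² + (h₀ + w₁h₁)² ≡ w₁² + h₀²` on
`[−B,B] × K` for polynomial functions `h₀ : ℝ^{d−1} → ℝ` (variables `v`) and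
`h₁ : ℝ^d → ℝ` (variables `(w₁, v)`), `K` compact. -/
theorem newton_diagram_equivalence_quadratic
    (d : ℕ) (h₀ : MvPolynomial (Fin d) ℝ) (h₁ : MvPolynomial (Fin (d + 1)) ℝ)
    (B : ℝ) (hB : 0 < B) (K : Set (Fin d → ℝ)) (hK : IsCompact K) :
    ∃ c C : ℝ, 0 < c ∧ c ≤ C ∧
      ∀ w₁ ∈ Set.Icc (-B) B, ∀ v ∈ K,
        c * (w₁ ^ 2 + MvPolynomial.eval v h₀ ^ 2) ≤
            w₁ ^ 2 + (MvPolynomial.eval v h₀ +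
              w₁ * MvPolynomial.eval (Fin.cons w₁ v) h₁) ^ 2 ∧
        w₁ ^ 2 + (MvPolynomial.eval v h₀ +
              w₁ * MvPolynomial.eval (Fin.cons w₁ v) h₁) ^ 2 ≤
          C * (w₁ ^ 2 + MvPolynomial.eval v h₀ ^ 2) := by
  obtain ⟨M, hM⟩ := h₁.exists_abs_eval_cons_le (isCompact_Icc (a := -B) (b := B)) hK
  have hC : 1 ≤ 2 + 2 * M ^ 2 := by nlinarith [sq_nonneg M]
  have hpos : 0 < 2 + 2 * M ^ 2 := by positivity
  refine ⟨(2 + 2 * M ^ 2)⁻¹, 2 + 2 * M ^ 2, inv_pos.mpr hpos,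
    (inv_le_one_of_one_le₀ hC).trans hC, fun w hw v hv => ⟨?_, sq_add_sq_add_mul_le (hM w hw v hv)⟩⟩
  rw [inv_mul_le_iff₀ hpos]
  have h := sq_add_sq_add_mul_le (w := w)
    (a := MvPolynomial.eval v h₀ + w * MvPolynomial.eval (Fin.cons w v) h₁)
    ((abs_neg _).trans_le (hM w hw v hv))
  rwa [mul_neg, add_neg_cancel_right] at h
end
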